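/- Let X be an involutive two-valued group. Then for any element x ∈ X there exists a unique sequence x⁰, x¹, x², … of elements of X such that x⁰ = e, x¹ = x and x*x^k = x^k*x = [x^{k−1}, x^{k+1}] for all k ≥ 1. -/

import Mathlib

/-!
Two-valued groups after V.M. Buchstaber, A.P. Veselov and A.A. Gaifullin.

`X.mul x y` is the two-element multiset `x * y`.
-/

universe u v w u' v' w'

/-- A two-valued group: a set with a multiplication valued in two-element multisets,
a strong identity `e`, and a (unique) inverse. -/
structure TwoValuedGroup (T : Type u) where
  mul : T → T → Multiset T
  e : T
  inv : T → T
  card_mul : ∀ x y, Multiset.card (mul x y) = 2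
  assoc : ∀ x y z, (mul x y).bind (fun t => mul t z) = (mul y z).bind (fun t => mul x t)
  e_mul : ∀ x, mul e x = {x, x}
  mul_e : ∀ x, mul x e = {x, x}
  e_mem_mul_inv : ∀ x, e ∈ mul x (inv x)
  e_mem_inv_mul : ∀ x, e ∈ mul (inv x) x
  inv_unique : ∀ x y, (e ∈ mul x y ∨ e ∈ mul y x) → y = inv x

namespace TwoValuedGroup

/-- Commutativity of a two-valued group. -/
def Commutative {T : Type u} (X : TwoValuedGroup T) : Prop := ∀ x y, X.mul x y = X.mul y x

/-- Involutivity: every element is its own inverse. -/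
def Involutive {T : Type u} (X : TwoValuedGroup T) : Prop := ∀ x, X.inv x = x

/-- A homomorphism of two-valued groups. -/
def IsHom {T : Type u} {S : Type v} (X : TwoValuedGroup T) (Z : TwoValuedGroup S)
    (f : T → S) : Prop :=
  f X.e = Z.e ∧ ∀ x y, (X.mul x y).map f = Z.mul (f x) (f y)

/-- Two two-valued groups are isomorphic if there is a bijective homomorphism. -/
def Isomorphic {T : Type u} {S : Type v} (X : TwoValuedGroup T) (Z : TwoValuedGroup S) : Prop :=
  ∃ f : T → S, Function.Bijective f ∧ IsHom X Z f

/-- A subgroup of a two-valued group: a subset closed under multiplication. -/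
def IsSubgroup {T : Type u} (X : TwoValuedGroup T) (Y : Set T) : Prop :=
  ∀ y₁ ∈ Y, ∀ y₂ ∈ Y, ∀ z ∈ X.mul y₁ y₂, z ∈ Y

/-- `S` generates `X` if the only subgroup of `X` containing `S` is all of `X`. -/
def Generates {T : Type u} (X : TwoValuedGroup T) (S : Set T) : Prop :=
  ∀ Y : Set T, X.IsSubgroup Y → S ⊆ Y → Y = Set.univ

/-- Finitely generated two-valued group. -/
def FinitelyGenerated {T : Type u} (X : TwoValuedGroup T) : Prop :=
  ∃ S : Set T, S.Finite ∧ X.Generates S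

/-- A family of integer power sequences: `P x k` is the `k`-th power `x^k` of `x`;
these are uniquely determined in an involutive two-valued group. -/
def IsPowFamily {T : Type u} (X : TwoValuedGroup T) (P : T → ℤ → T) : Prop :=
  ∀ x : T, P x 0 = X.e ∧ P x 1 = x ∧ (∀ k : ℤ, P x (-k) = P x k) ∧
    ∀ k : ℤ, 1 ≤ k → X.mul x (P x k) = {P x (k - 1), P x (k + 1)}

/-- The order of an element: the least positive `k` with `x^k = e`;
the value `0` encodes infinite order. -/
noncomputable def ordOf {T : Type u} (X : TwoValuedGroup T) (P : T → ℤ → T) (x : T) : ℕ :=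
  sInf {n : ℕ | 0 < n ∧ P x (n : ℤ) = X.e}

/-- `ord x > 2` (where infinite order counts as `> 2`). -/
def OrdGT2 {T : Type u} (X : TwoValuedGroup T) (P : T → ℤ → T) (x : T) : Prop :=
  X.ordOf P x = 0 ∨ 2 < X.ordOf P x

/-- A two-valued group is special if it contains a special pair: `ord x > 2`, `ord y > 2`,
and `x * y` consists of two equal elements. -/
def IsSpecial {T : Type u} (X : TwoValuedGroup T) (P : T → ℤ → T) : Prop :=
  ∃ x y z : T, X.OrdGT2 P x ∧ X.OrdGT2 P y ∧ X.mul x y = {z, z}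

/-- `ι` is an involutive automorphism of the group `G`. -/
def IsInvolutiveAut (G : Type v) [Group G] (ι : G → G) : Prop :=
  Function.Bijective ι ∧ (∀ g h : G, ι (g * h) = ι g * ι h) ∧ (∀ g : G, ι (ι g) = g)

/-- `X` is isomorphic to the coset two-valued group `G/ι`: there is a quotient map
`π : G → X` whose fibres are exactly the `ι`-orbits and which carries the coset
two-valued multiplication `π g * π h = [π (g h), π (g ι(h))]`. -/
def IsCosetOf {T : Type u} {G : Type v} [Group G] (X : TwoValuedGroup T) (ι : G → G) : Prop :=
  ∃ π : G → T, Function.Surjective π ∧ π 1 = X.e ∧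
    (∀ g, π (ι g) = π g) ∧
    (∀ g h, π g = π h → h = g ∨ h = ι g) ∧
    (∀ g h, X.mul (π g) (π h) = {π (g * h), π (g * ι h)}) ∧
    (∀ g, X.inv (π g) = π g⁻¹)

/-- `X` is isomorphic to the coset two-valued group `X^a_A = A/ι_a`
for the antipodal involution `ι_a (a) = a⁻¹` of the abelian group `A`. -/
def IsAntipodalCosetOf {T : Type u} (X : TwoValuedGroup T) (A : Type v) [CommGroup A] : Prop :=
  ∃ π : A → T, Function.Surjective π ∧ π 1 = X.e ∧
    (∀ a, π a⁻¹ = π a) ∧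
    (∀ a b, π a = π b → b = a ∨ b = a⁻¹) ∧
    (∀ a b, X.mul (π a) (π b) = {π (a * b), π (a * b⁻¹)}) ∧
    (∀ a, X.inv (π a) = π a⁻¹)

/-- A Boolean group: every element squares to the identity. -/
def IsBooleanGroup (V : Type v) [CommGroup V] : Prop := ∀ x : V, x * x = 1

/-- For a Boolean group, `dim V ≥ 2` (as an `𝔽₂`-vector space) is equivalent to the
existence of two distinct nontrivial elements. -/
def BoolDimGE2 (V : Type v) [CommGroup V] : Prop := ∃ a b : V, a ≠ 1 ∧ b ≠ 1 ∧ a ≠ b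

/-- For a Boolean group, `dim V ≥ 3` is equivalent to the existence of three
linearly independent elements. -/
def BoolDimGE3 (V : Type v) [CommGroup V] : Prop :=
  ∃ a b c : V, a ≠ 1 ∧ b ≠ 1 ∧ a ≠ b ∧ c ≠ 1 ∧ c ≠ a ∧ c ≠ b ∧ c ≠ a * b

/-- Isomorphism of (single-valued) groups. -/
def GroupIsomorphic (A : Type v) (B : Type w) [CommGroup A] [CommGroup B] : Prop :=
  Nonempty (A ≃* B)

/-- `X` is isomorphic to the coset two-valued group `X^u_V = (V × V)/ι_u`,
where `ι_u (a, b) = (a, a b)` is the unipotent involution of the Boolean group `V × V`. -/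
def IsUnipotentCosetOf {T : Type u} (X : TwoValuedGroup T) (V : Type v) [CommGroup V] : Prop :=
  ∃ π : V × V → T, Function.Surjective π ∧ π (1, 1) = X.e ∧
    (∀ a b : V, π (a, a * b) = π (a, b)) ∧
    (∀ p q : V × V, π p = π q → q = p ∨ q = (p.1, p.1 * p.2)) ∧
    (∀ a₁ b₁ a₂ b₂ : V,
      X.mul (π (a₁, b₁)) (π (a₂, b₂)) = {π (a₁ * a₂, b₁ * b₂), π (a₁ * a₂, a₂ * b₁ * b₂)}) ∧
    (∀ p : V × V, X.inv (π p) = π p)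

/-- `X` is isomorphic to the direct product `X^u_V × W` of the unipotent coset
two-valued group `X^u_V = (V × V)/ι_u` and the Boolean group `W`. -/
def IsUnipotentCosetProdOf {T : Type u} (X : TwoValuedGroup T) (V : Type v) (W : Type w)
    [CommGroup V] [CommGroup W] : Prop :=
  ∃ f : (V × V) × W → T, Function.Surjective f ∧ f ((1, 1), 1) = X.e ∧
    (∀ (a b : V) (w : W), f ((a, a * b), w) = f ((a, b), w)) ∧
    (∀ p q : (V × V) × W, f p = f q → q.2 = p.2 ∧ (q.1 = p.1 ∨ q.1 = (p.1.1, p.1.1 * p.1.2))) ∧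
    (∀ (a₁ b₁ a₂ b₂ : V) (w₁ w₂ : W),
      X.mul (f ((a₁, b₁), w₁)) (f ((a₂, b₂), w₂)) =
        {f ((a₁ * a₂, b₁ * b₂), w₁ * w₂), f ((a₁ * a₂, a₂ * b₁ * b₂), w₁ * w₂)}) ∧
    (∀ p, X.inv (f p) = f p)

open Classical in
/-- The multiplication table of the special two-valued group `Y_V` on `Option V`:
`none` is the extra element `s`, `some v` are the elements of the Boolean group `V`. -/
noncomputable def mulY {V : Type v} [CommGroup V] : Option V → Option V → Multiset (Option V)
  | some x, some y =>
      if x = y then (if x = 1 then {some 1, some 1} else {some 1, none})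
      else {some (x * y), some (x * y)}
  | some x, none => if x = 1 then {none, none} else {some x, some x}
  | none, some y => if y = 1 then {none, none} else {some y, some y}
  | none, none => {some 1, some 1}

/-- `X` is isomorphic to the special two-valued group `Y_V`. -/
def IsYOf {T : Type u} (X : TwoValuedGroup T) (V : Type v) [CommGroup V] : Prop :=
  ∃ f : Option V → T, Function.Bijective f ∧ f (some 1) = X.e ∧
    (∀ uu vv : Option V, X.mul (f uu) (f vv) = (mulY uu vv).map f) ∧
    (∀ uu : Option V, X.inv (f uu) = f uu)

/-- `X` is isomorphic to the direct product `Y_V × W`. -/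
def IsYProdOf {T : Type u} (X : TwoValuedGroup T) (V : Type v) (W : Type w)
    [CommGroup V] [CommGroup W] : Prop :=
  ∃ f : Option V × W → T, Function.Bijective f ∧ f (some 1, 1) = X.e ∧
    (∀ (uu vv : Option V) (w₁ w₂ : W),
      X.mul (f (uu, w₁)) (f (vv, w₂)) = (mulY uu vv).map (fun z => f (z, w₁ * w₂))) ∧
    (∀ p : Option V × W, X.inv (f p) = f p)

/-- `X` is isomorphic to the direct product `X' × W` of the two-valued group `X'`
and the (single-valued) Boolean group `W`. -/
def IsDirectProdOf {T : Type u} {T' : Type v} (W : Type w) [CommGroup W]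
    (X : TwoValuedGroup T) (X' : TwoValuedGroup T') : Prop :=
  ∃ f : T' × W → T, Function.Bijective f ∧ f (X'.e, 1) = X.e ∧
    (∀ (x₁ x₂ : T') (w₁ w₂ : W),
      X.mul (f (x₁, w₁)) (f (x₂, w₂)) = (X'.mul x₁ x₂).map (fun z => f (z, w₁ * w₂))) ∧
    (∀ (x : T') (w : W), X.inv (f (x, w)) = f (X'.inv x, w))

/-- `X` contains a single-valued direct factor: `X ≅ X' × W` with `W` a nontrivial
Boolean group. -/
def HasSingleValuedDirectFactor {T : Type u} (X : TwoValuedGroup T) : Prop :=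
  ∃ (T' : Type u) (X' : TwoValuedGroup T') (W : Type u) (iW : CommGroup W),
    X'.Commutative ∧ X'.Involutive ∧ @IsBooleanGroup W iW ∧ Nontrivial W ∧
    @IsDirectProdOf T T' W iW X X'

/-- The Boolean group `C₂ⁿ`. -/
abbrev C2vec (n : ℕ) : Type := Fin n → Multiplicative (ZMod 2)

/-- The group `C₄ⁿ`. -/
abbrev C4vec (n : ℕ) : Type := Fin n → Multiplicative (ZMod 4)

end TwoValuedGroup

namespace TwoValuedGroup

/-- In an involutive two-valued group, membership in a product is cyclically symmetric. -/
theorem Involutive.mem_mul_rotate {T : Type u} {X : TwoValuedGroup T} (hinv : X.Involutive)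
    {a b c : T} (h : c ∈ X.mul a b) : a ∈ X.mul b c := by
  have hc : X.e ∈ (X.mul a b).bind (fun t => X.mul t c) := by
    refine Multiset.mem_bind.2 ⟨c, h, ?_⟩
    simpa only [hinv c] using X.e_mem_mul_inv c
  rw [X.assoc] at hc
  obtain ⟨t, ht, he⟩ := Multiset.mem_bind.1 hc
  have hta : t = a := (X.inv_unique a t (Or.inl he)).trans (hinv a)
  rwa [hta] at ht

/-- A product containing `a` has the form `{a, c}`. -/
theorem exists_mul_eq_pair {T : Type u} (X : TwoValuedGroup T) {x y a : T}
    (h : a ∈ X.mul x y) : ∃ c, X.mul x y = {a, c} := by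
  obtain ⟨s, hs⟩ := Multiset.exists_cons_of_mem h
  have hcard := X.card_mul x y
  rw [hs, Multiset.card_cons] at hcard
  obtain ⟨c, rfl⟩ := Multiset.card_eq_one.1 (Nat.succ.inj hcard)
  exact ⟨c, hs⟩

/-- If `x` commutes with `a` and `b` and `x * b = [a, c]`, then `x` commutes with `c`. -/
theorem mul_comm_of_mul_eq_pair {T : Type u} (X : TwoValuedGroup T) {x a b c : T}
    (ha : X.mul x a = X.mul a x) (hb : X.mul x b = X.mul b x) (h : X.mul x b = {a, c}) :
    X.mul x c = X.mul c x := by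
  have hassoc := X.assoc x b x
  rw [← hb, h] at hassoc
  simp only [Multiset.insert_eq_cons, Multiset.cons_bind, Multiset.singleton_bind, ha]
    at hassoc
  exact (add_left_cancel hassoc).symm

/-- A pair `(a, b)` that can occur as two consecutive powers of `x`. -/
def IsConsecutive {T : Type u} (X : TwoValuedGroup T) (x : T) (q : T × T) : Prop :=
  X.mul x q.1 = X.mul q.1 x ∧ X.mul x q.2 = X.mul q.2 x ∧ q.1 ∈ X.mul x q.2

theorem IsConsecutive.exists_next {T : Type u} {X : TwoValuedGroup T} (hinv : X.Involutive)
    {x : T} {q : T × T} (hq : X.IsConsecutive x q) :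
    ∃ c, X.mul x q.2 = {q.1, c} ∧ X.IsConsecutive x (q.2, c) := by
  obtain ⟨ha, hb, hmem⟩ := hq
  obtain ⟨c, hc⟩ := X.exists_mul_eq_pair hmem
  have hcomm := X.mul_comm_of_mul_eq_pair ha hb hc
  have hcx : c ∈ X.mul x q.2 := by simp [hc]
  refine ⟨c, hc, hb, hcomm, ?_⟩
  rw [hcomm]
  exact hinv.mem_mul_rotate (hinv.mem_mul_rotate hcx)

/-- **Lemma 2.3 (lem_sequence).** In an involutive two-valued group, every element `x`
has a unique sequence of powers `x⁰, x¹, x², …` with `x⁰ = e`, `x¹ = x` and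
`x * x^k = x^k * x = [x^{k-1}, x^{k+1}]` for all `k ≥ 1`. -/
theorem existsUnique_pow_sequence {T : Type u} (X : TwoValuedGroup T)
    (hinv : X.Involutive) (x : T) :
    ∃! p : ℕ → T, p 0 = X.e ∧ p 1 = x ∧
      ∀ k : ℕ, 1 ≤ k →
        X.mul x (p k) = {p (k - 1), p (k + 1)} ∧ X.mul (p k) x = {p (k - 1), p (k + 1)} := by
  have hstart : X.IsConsecutive x (X.e, x) :=
    ⟨(X.mul_e x).trans (X.e_mul x).symm, rfl, by
      simpa only [hinv x] using X.e_mem_mul_inv x⟩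
  choose next hnext hcons using
    fun q : {q : T × T // X.IsConsecutive x q} => q.2.exists_next hinv
  let step : {q : T × T // X.IsConsecutive x q} → {q : T × T // X.IsConsecutive x q} :=
    fun q => ⟨(q.1.2, next q), hcons q⟩
  let s : ℕ → {q : T × T // X.IsConsecutive x q} :=
    fun n => Nat.rec ⟨(X.e, x), hstart⟩ (fun _ q => step q) n
  refine ⟨fun n => (s n).1.1, ⟨rfl, rfl, fun k hk => ?_⟩, ?_⟩
  · obtain ⟨n, rfl⟩ := Nat.exists_eq_add_of_le' hk
    have h : X.mul x (s n).1.2 = {(s n).1.1, next (s n)} := hnext (s n)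
    exact ⟨h, (s n).2.2.1.symm.trans h⟩
  · rintro p ⟨hp₀, hp₁, hp⟩
    have hpair : ∀ n, p n = (s n).1.1 ∧ p (n + 1) = (s n).1.2 := by
      intro n
      induction n with
      | zero => exact ⟨hp₀, hp₁⟩
      | succ n ih =>
        refine ⟨ih.2, ?_⟩
        have h := (hp (n + 1) n.succ_pos).1
        rw [Nat.add_sub_cancel, ih.1, ih.2, hnext (s n)] at h
        exact (Multiset.singleton_inj.1 ((Multiset.cons_inj_right _).1 h)).symm
    exact funext fun n => (hpair n).1

end TwoValuedGroup
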